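/- Identify (1+n)-dimensional Minkowski space with ℝ × ℝⁿ equipped with the Minkowski quadratic form Q(s, v) = ‖v‖² − s². Let c > 0 and let f : ℝ × ℝⁿ → ℝ be a C² function that is spacetime convex with constant c, i.e. its second derivative satisfies D²f(p)(w, w) ≥ c·Q(w) for every point p and every vector w = (s, v). Let γ(λ) = a + λ·b be an affine curve (a geodesic of flat spacetime) whose velocity b = (s₀, v₀) is spacelike, i.e. Q(b) = ‖v₀‖² − s₀² > 0. Then the composition g = f ∘ γ satisfies g''(λ) ≥ c·Q(b) > 0 for all λ, and consequently g is not periodic: there is no L > 0 with f(γ(λ + L)) = f(γ(λ)) for all λ. -/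

import Mathlib

open scoped RealInnerProductSpace

section AffineComposition

variable {E F : Type*} [NormedAddCommGroup E] [NormedSpace ℝ E]
  [NormedAddCommGroup F] [NormedSpace ℝ F]

theorem hasDerivAt_comp_add_smul {f : E → F} (hf : Differentiable ℝ f) (a b : E) (t : ℝ) :
    HasDerivAt (fun t : ℝ => f (a + t • b)) (fderiv ℝ f (a + t • b) b) t := by
  have hγ : HasDerivAt (fun t : ℝ => a + t • b) b t := by
    simpa using ((hasDerivAt_id t).smul_const b).const_add a
  exact (hf (a + t • b)).hasFDerivAt.comp_hasDerivAt t hγ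

theorem deriv_deriv_comp_add_smul {f : E → F} (hf : ContDiff ℝ 2 f) (a b : E) (t : ℝ) :
    deriv (deriv (fun t : ℝ => f (a + t • b))) t =
      iteratedFDeriv ℝ 2 f (a + t • b) ![b, b] := by
  have hderiv : deriv (fun t : ℝ => f (a + t • b)) = fun t => fderiv ℝ f (a + t • b) b :=
    funext fun t => (hasDerivAt_comp_add_smul (hf.differentiable (by norm_num)) a b t).deriv
  have hf' : Differentiable ℝ (fderiv ℝ f) :=
    (hf.fderiv_right (m := 1) (by norm_num)).differentiable (by norm_num)
  have h := (hasDerivAt_comp_add_smul hf' a b t).clm_apply (hasDerivAt_const t b)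
  rw [hderiv, h.deriv, iteratedFDeriv_two_apply]
  simp

end AffineComposition

theorem Function.Periodic.deriv {F : Type*} [NormedAddCommGroup F] [NormedSpace ℝ F]
    {g : ℝ → F} {L : ℝ} (hg : Function.Periodic g L) : Function.Periodic (deriv g) L := by
  intro t
  rw [← deriv_comp_add_const, funext hg]

theorem not_periodic_of_deriv_deriv_pos {g : ℝ → ℝ} (hg : ∀ t, 0 < deriv (deriv g) t)
    {L : ℝ} (hL : 0 < L) : ¬ Function.Periodic g L := by
  intro hper
  have hlt := strictMono_of_deriv_pos hg hL
  have heq := hper.deriv 0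
  rw [zero_add] at heq
  exact hlt.ne' heq

/-- In flat `(1+n)`-dimensional Minkowski spacetime `ℝ × ℝⁿ` with Minkowski quadratic
form `Q (s, v) = ‖v‖² − s²`, a spacetime convex function with constant `c > 0` composed
with an affine (geodesic) curve with spacelike velocity `b` has second derivative bounded
below by `c · Q b > 0`, and hence the composition is not periodic: there is no closed
spacelike geodesic along which `f` is well defined and periodic. -/
theorem spacetime_convex_no_closed_spacelike_geodesic
    (n : ℕ) (c : ℝ) (hc : 0 < c)
    (f : ℝ × EuclideanSpace ℝ (Fin n) → ℝ)
    (hf : ContDiff ℝ 2 f)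
    (hconv : ∀ p w : ℝ × EuclideanSpace ℝ (Fin n),
      c * (‖w.2‖ ^ 2 - w.1 ^ 2) ≤ iteratedFDeriv ℝ 2 f p ![w, w])
    (a b : ℝ × EuclideanSpace ℝ (Fin n))
    (hb : 0 < ‖b.2‖ ^ 2 - b.1 ^ 2) :
    (∀ lam : ℝ,
        c * (‖b.2‖ ^ 2 - b.1 ^ 2) ≤
          deriv (deriv (fun lam : ℝ => f (a + lam • b))) lam) ∧
    (0 < c * (‖b.2‖ ^ 2 - b.1 ^ 2)) ∧
    ¬ ∃ L : ℝ, 0 < L ∧ ∀ lam : ℝ, f (a + (lam + L) • b) = f (a + lam • b) := by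
  have hpos : 0 < c * (‖b.2‖ ^ 2 - b.1 ^ 2) := mul_pos hc hb
  have hbound : ∀ lam : ℝ, c * (‖b.2‖ ^ 2 - b.1 ^ 2) ≤
      deriv (deriv (fun lam : ℝ => f (a + lam • b))) lam := fun lam => by
    rw [deriv_deriv_comp_add_smul hf]
    exact hconv _ b
  refine ⟨hbound, hpos, ?_⟩
  rintro ⟨L, hL, hper⟩
  exact not_periodic_of_deriv_deriv_pos (fun t => hpos.trans_le (hbound t)) hL hper
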